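/- Let N ≥ 2, n ≥ 1, and let R = √N·V for a real orthogonal N×N matrix V whose first column is (1/√N)·𝟙_N, with R⁻¹ = (1/N)·Rᵀ and lower-right (N−1)×(N−1) block R₂₂ of R⁻¹. For x = (x₁ᵀ,…,x_Nᵀ)ᵀ ∈ ℝ^{nN} with x_i ∈ ℝⁿ, define e = (R⁻¹ ⊗ I_n)·x and let ē ∈ ℝ^{n(N−1)} be the vector of its last n(N−1) components. Then ē = (R₂₂ ⊗ I_n)·(x̄ − 𝟙_{N−1} ⊗ x₁), where x̄ = (x₂ᵀ,…,x_Nᵀ)ᵀ, and ē = 0 if and only if x₁ = x₂ = … = x_N. -/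

import Mathlib

open Matrix
open scoped Kronecker

noncomputable section

/-- The index `0` of `Fin N` when `N ≥ 2`. -/
def e0 {N : ℕ} (hN : 2 ≤ N) : Fin N := ⟨0, by omega⟩

/-- The embedding `Fin (N-1) → Fin N`, `i ↦ i + 1`. -/
def emb {N : ℕ} (hN : 2 ≤ N) (i : Fin (N - 1)) : Fin N :=
  ⟨i.1 + 1, by have := i.2; omega⟩

/-- Given an orthogonal matrix `V`, `Rinv V = (1/N)·Rᵀ` where `R = √N·V`. -/
def Rinv {N : ℕ} (V : Matrix (Fin N) (Fin N) ℝ) : Matrix (Fin N) (Fin N) ℝ :=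
  (1 / (N : ℝ)) • (Real.sqrt N • V).transpose

/-- The lower-right `(N-1)×(N-1)` block of `R⁻¹`. -/
def R22 {N : ℕ} (hN : 2 ≤ N) (V : Matrix (Fin N) (Fin N) ℝ) :
    Matrix (Fin (N - 1)) (Fin (N - 1)) ℝ :=
  Matrix.of fun i j => Rinv V (emb hN i) (emb hN j)

/-- The block-diagonal matrix `diag(A₁,…,A_N)` on `ℝ^{nN}`. -/
def blockDiag {N n : ℕ} (A : Fin N → Matrix (Fin n) (Fin n) ℝ) :
    Matrix (Fin N × Fin n) (Fin N × Fin n) ℝ :=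
  Matrix.of fun p q => if p.1 = q.1 then A p.1 p.2 q.2 else 0

/-- `Ψ = (R⁻¹ ⊗ I_n)·Â·(R ⊗ I_n)` where `R = √N·V` and `Â = diag(A₁,…,A_N)`. -/
def PsiM {N n : ℕ} (V : Matrix (Fin N) (Fin N) ℝ)
    (A : Fin N → Matrix (Fin n) (Fin n) ℝ) :
    Matrix (Fin N × Fin n) (Fin N × Fin n) ℝ :=
  (Rinv V ⊗ₖ (1 : Matrix (Fin n) (Fin n) ℝ)) * blockDiag A *
    ((Real.sqrt N • V) ⊗ₖ (1 : Matrix (Fin n) (Fin n) ℝ))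

/-- The action of `A ⊗ I` computed componentwise. -/
theorem kronecker_one_mulVec_apply {l m k R : Type*} [Fintype m] [Fintype k] [DecidableEq k]
    [CommSemiring R] (A : Matrix l m R) (x : m × k → R) (i : l) (a : k) :
    ((A ⊗ₖ (1 : Matrix k k R)) *ᵥ x) (i, a) = ∑ j, A i j * x (j, a) := by
  simp [Matrix.mulVec, dotProduct, Fintype.sum_prod_type, Matrix.one_apply]

theorem emb_ne_e0 {N : ℕ} (hN : 2 ≤ N) (i : Fin (N - 1)) : emb hN i ≠ e0 hN := by
  simp [emb, e0, Fin.ext_iff]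

theorem sum_eq_e0_add_sum_emb {N : ℕ} (hN : 2 ≤ N) {M : Type*} [AddCommMonoid M]
    (f : Fin N → M) : ∑ j, f j = f (e0 hN) + ∑ k, f (emb hN k) := by
  obtain ⟨m, rfl⟩ : ∃ m, N = m + 1 := ⟨N - 1, by omega⟩
  exact Fin.sum_univ_succ f

theorem Rinv_apply {N : ℕ} (V : Matrix (Fin N) (Fin N) ℝ) (i j : Fin N) :
    Rinv V i j = √N / N * V j i := by
  simp only [Rinv, Matrix.smul_apply, Matrix.transpose_apply, smul_eq_mul]
  ring

/-- All rows of `R⁻¹` but the first sum to zero. -/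
theorem sum_Rinv_emb {N : ℕ} (hN : 2 ≤ N) (V : Matrix (Fin N) (Fin N) ℝ)
    (hV : V.transpose * V = 1) (hcol : ∀ i : Fin N, V i (e0 hN) = 1 / √N)
    (k : Fin (N - 1)) : ∑ j, Rinv V (emb hN k) j = 0 := by
  have hs : √(N : ℝ) ≠ 0 := (Real.sqrt_pos.2 (by positivity)).ne'
  have h := congrFun (congrFun hV (emb hN k)) (e0 hN)
  simp only [Matrix.mul_apply, Matrix.transpose_apply, hcol, Matrix.one_apply_ne (emb_ne_e0 hN k),
    ← Finset.sum_mul] at h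
  simp only [Rinv_apply, ← Finset.mul_sum]
  rw [(mul_eq_zero.1 h).resolve_right (one_div_ne_zero hs), mul_zero]

/-- A vector orthogonal to every column of `V` but the first is constant. -/
theorem eq_of_sum_Rinv_emb_mul_eq_zero {N : ℕ} (hN : 2 ≤ N) (V : Matrix (Fin N) (Fin N) ℝ)
    (hV : V.transpose * V = 1) (hcol : ∀ i : Fin N, V i (e0 hN) = 1 / √N) (y : Fin N → ℝ)
    (hy : ∀ k, ∑ j, Rinv V (emb hN k) j * y j = 0) (i : Fin N) :
    y i = 1 / √N * (V.transpose *ᵥ y) (e0 hN) := by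
  have hNpos : (0 : ℝ) < N := by positivity
  have hs : √(N : ℝ) ≠ 0 := (Real.sqrt_pos.2 hNpos).ne'
  have h : ∀ k, (V.transpose *ᵥ y) (emb hN k) = 0 := by
    intro k
    have hk := hy k
    simp only [Rinv_apply, mul_assoc, ← Finset.mul_sum] at hk
    exact (mul_eq_zero.1 hk).resolve_left (div_ne_zero hs hNpos.ne')
  calc y i = (V *ᵥ (V.transpose *ᵥ y)) i := by
        rw [Matrix.mulVec_mulVec, mul_eq_one_comm.1 hV, Matrix.one_mulVec]
    _ = ∑ j, V i j * (V.transpose *ᵥ y) j := rfl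
    _ = 1 / √N * (V.transpose *ᵥ y) (e0 hN) := by
        simp [sum_eq_e0_add_sum_emb hN, h, hcol]

/-- With `e = (R⁻¹ ⊗ I_n)·x` and `ē` its last `n(N−1)` components,
`ē = (R₂₂ ⊗ I_n)·(x̄ − 𝟙 ⊗ x₁)`, and `ē = 0` iff `x₁ = x₂ = … = x_N`. -/
theorem stmt_11 {N n : ℕ} (hN : 2 ≤ N) (hn : 1 ≤ n)
    (V : Matrix (Fin N) (Fin N) ℝ)
    (hV : V.transpose * V = 1)
    (hcol : ∀ i : Fin N, V i (e0 hN) = 1 / Real.sqrt N)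
    (x : Fin N × Fin n → ℝ) :
    let e : Fin N × Fin n → ℝ :=
      (Rinv V ⊗ₖ (1 : Matrix (Fin n) (Fin n) ℝ)).mulVec x
    let ebar : Fin (N - 1) × Fin n → ℝ := fun p => e (emb hN p.1, p.2)
    ebar = ((R22 hN V) ⊗ₖ (1 : Matrix (Fin n) (Fin n) ℝ)).mulVec
        (fun p => x (emb hN p.1, p.2) - x (e0 hN, p.2)) ∧
    (ebar = 0 ↔ ∀ (i j : Fin N) (a : Fin n), x (i, a) = x (j, a)) := by
  intro e ebar
  have he : ∀ k a, ebar (k, a) = ∑ j, Rinv V (emb hN k) j * x (j, a) := fun k a =>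
    kronecker_one_mulVec_apply (Rinv V) x (emb hN k) a
  have hsum := sum_Rinv_emb hN V hV hcol
  refine ⟨?_, fun h i j a => ?_, fun h => ?_⟩
  · ext ⟨k, a⟩
    have hk := hsum k
    rw [sum_eq_e0_add_sum_emb hN] at hk
    rw [he, kronecker_one_mulVec_apply, sum_eq_e0_add_sum_emb hN]
    simp only [R22, Matrix.of_apply, mul_sub, Finset.sum_sub_distrib, ← Finset.sum_mul]
    linear_combination x (e0 hN, a) * hk
  · have hy := eq_of_sum_Rinv_emb_mul_eq_zero hN V hV hcol (fun j => x (j, a))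
      fun k => (he k a).symm.trans (congrFun h (k, a))
    exact (hy i).trans (hy j).symm
  · ext ⟨k, a⟩
    rw [he, Finset.sum_congr rfl fun j _ => by rw [h j (e0 hN) a], ← Finset.sum_mul, hsum,
      zero_mul, Pi.zero_apply]

end
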